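/- Let x be a stable divisible allocation with profile h*, for the same instance viewed with indivisible items. Then: (1) if d is a natural number such that every stable (indivisible) allocation assigns exactly d items to agent i, then h*_i = d; (2) if d is a natural number such that some stable (indivisible) allocation assigns exactly d items to agent i and some stable (indivisible) allocation assigns exactly d − 1 items to agent i, then d − 1 ≤ h*_i ≤ d. -/

import Mathlib

open Finset

/-- `χ` is a (partial) allocation of `m` indivisible items to `n` agents respecting `likes`:
whenever item `o` is assigned to agent `j`, agent `j` likes item `o`. -/
def IsAlloc {m n : ℕ} (likes : Fin n → Fin m → Prop) (χ : Fin m → Option (Fin n)) : Prop :=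
  ∀ o j, χ o = some j → likes j o

/-- The profile of an allocation: agent `j` receives `prof χ j` items. -/
def prof {m n : ℕ} (χ : Fin m → Option (Fin n)) (j : Fin n) : ℕ :=
  (Finset.univ.filter fun o => χ o = some j).card

/-- Utilitarian social welfare: the total number of allocated items. -/
def usw {m n : ℕ} (χ : Fin m → Option (Fin n)) : ℕ := ∑ j, prof χ j

/-- A max-USW allocation. -/
def MaxUSW {m n : ℕ} (likes : Fin n → Fin m → Prop) (χ : Fin m → Option (Fin n)) : Prop :=
  IsAlloc likes χ ∧ ∀ χ', IsAlloc likes χ' → usw χ' ≤ usw χ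

/-- A transfer path in `χ` from agent `u` to agent `v`: pairwise distinct agents
`a 0 = u, …, a k = v` (`k ≥ 1`) and items `o 0, …, o (k-1)` with `χ` assigning `o t` to
`a t` and agent `a (t+1)` liking `o t`. -/
def TransferPath {m n : ℕ} (likes : Fin n → Fin m → Prop) (χ : Fin m → Option (Fin n))
    (u v : Fin n) : Prop :=
  ∃ k : ℕ, 1 ≤ k ∧ ∃ a : Fin (k + 1) → Fin n, Function.Injective a ∧
    a 0 = u ∧ a (Fin.last k) = v ∧
    ∃ o : Fin k → Fin m, ∀ t : Fin k,
      χ (o t) = some (a t.castSucc) ∧ likes (a t.succ) (o t)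

/-- `χ` admits a narrowing transfer: a transfer path from `u` to `v` with `h_u ≥ h_v + 2`. -/
def Narrowing {m n : ℕ} (likes : Fin n → Fin m → Prop) (χ : Fin m → Option (Fin n)) : Prop :=
  ∃ u v, TransferPath likes χ u v ∧ prof χ v + 2 ≤ prof χ u

/-- A stable allocation: max-USW and admitting no narrowing transfer. -/
def Stable {m n : ℕ} (likes : Fin n → Fin m → Prop) (χ : Fin m → Option (Fin n)) : Prop :=
  MaxUSW likes χ ∧ ¬ Narrowing likes χ

/-- The profile of `χ` sorted in ascending order. -/
noncomputable def sortedProf {m n : ℕ} (χ : Fin m → Option (Fin n)) : Fin n → ℕ :=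
  prof χ ∘ Tuple.sort (prof χ)

/-- `x` is a divisible allocation of `m` divisible items to `n` agents respecting `likes`:
fractions are nonnegative, zero on disliked items, and each item is allocated to total
extent at most `1`. -/
def IsDAlloc {m n : ℕ} (likes : Fin n → Fin m → Prop) (x : Fin m → Fin n → ℝ) : Prop :=
  (∀ o j, 0 ≤ x o j) ∧ (∀ o j, ¬ likes j o → x o j = 0) ∧ (∀ o, ∑ j, x o j ≤ 1)

/-- The profile of a divisible allocation: agent `j` receives total amount `dprof x j`. -/
def dprof {m n : ℕ} (x : Fin m → Fin n → ℝ) (j : Fin n) : ℝ := ∑ o, x o j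

/-- A max-USW divisible allocation: the total allocated amount is maximal. -/
def DMaxUSW {m n : ℕ} (likes : Fin n → Fin m → Prop) (x : Fin m → Fin n → ℝ) : Prop :=
  IsDAlloc likes x ∧
    ∀ x', IsDAlloc likes x' → ∑ o, ∑ j, x' o j ≤ ∑ o, ∑ j, x o j

/-- A transfer path in a divisible allocation `x` from agent `u` to agent `v`: pairwise
distinct agents `a 0 = u, …, a k = v` (`k ≥ 1`) and items `o 0, …, o (k-1)` with
`x (o t) (a t) > 0` and agent `a (t+1)` liking `o t`. -/
def DTransferPath {m n : ℕ} (likes : Fin n → Fin m → Prop) (x : Fin m → Fin n → ℝ)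
    (u v : Fin n) : Prop :=
  ∃ k : ℕ, 1 ≤ k ∧ ∃ a : Fin (k + 1) → Fin n, Function.Injective a ∧
    a 0 = u ∧ a (Fin.last k) = v ∧
    ∃ o : Fin k → Fin m, ∀ t : Fin k,
      0 < x (o t) (a t.castSucc) ∧ likes (a t.succ) (o t)

/-- `x` admits a narrowing transfer: a transfer path from `u` to `v` with `h_u > h_v`. -/
def DNarrowing {m n : ℕ} (likes : Fin n → Fin m → Prop) (x : Fin m → Fin n → ℝ) : Prop :=
  ∃ u v, DTransferPath likes x u v ∧ dprof x v < dprof x u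

/-- A stable divisible allocation: max-USW and admitting no narrowing transfer. -/
def DStable {m n : ℕ} (likes : Fin n → Fin m → Prop) (x : Fin m → Fin n → ℝ) : Prop :=
  DMaxUSW likes x ∧ ¬ DNarrowing likes x

/-- The profile of `x` sorted in ascending order. -/
noncomputable def sortedDProf {m n : ℕ} (x : Fin m → Fin n → ℝ) : Fin n → ℝ :=
  dprof x ∘ Tuple.sort (dprof x)

lemma prof_update_some {m n : ℕ} (χ : Fin m → Option (Fin n)) (o : Fin m) (b w : Fin n) :
    prof (Function.update χ o (some b)) w + (if χ o = some w then 1 else 0) =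
      prof χ w + (if b = w then 1 else 0) := by
  classical
  simp only [prof, Finset.card_filter]
  rw [← Finset.add_sum_erase _ _ (Finset.mem_univ o),
    ← Finset.add_sum_erase (a := o) _ (fun o => if χ o = some w then 1 else 0)
      (Finset.mem_univ o)]
  have h : ∑ o' ∈ Finset.univ.erase o,
      (if Function.update χ o (some b) o' = some w then 1 else 0) =
      ∑ o' ∈ Finset.univ.erase o, (if χ o' = some w then 1 else 0) := by
    refine Finset.sum_congr rfl fun o' ho' => ?_
    rw [Function.update_of_ne (Finset.ne_of_mem_erase ho')]
  rw [h]
  simp only [Function.update_self, Option.some.injEq]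
  omega

lemma IsAlloc.update {m n : ℕ} {likes : Fin n → Fin m → Prop} {χ : Fin m → Option (Fin n)}
    (hχ : IsAlloc likes χ) {o : Fin m} {b : Fin n} (hb : likes b o) :
    IsAlloc likes (Function.update χ o (some b)) := by
  intro o' j h
  by_cases ho : o' = o
  · subst ho
    simp only [Function.update_self, Option.some.injEq] at h
    exact h ▸ hb
  · rw [Function.update_of_ne ho] at h
    exact hχ o' j h

/-- In a max-USW allocation every liked item is assigned. -/
lemma MaxUSW.exists_owner {m n : ℕ} {likes : Fin n → Fin m → Prop}
    {χ : Fin m → Option (Fin n)} (hχ : MaxUSW likes χ) {o : Fin m} {b : Fin n}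
    (hb : likes b o) : ∃ s, χ o = some s := by
  by_contra! h
  have h₁ : ∀ w, prof (Function.update χ o (some b)) w =
      prof χ w + (if b = w then 1 else 0) := fun w => by
    simpa [h w] using prof_update_some χ o b w
  have h₂ := hχ.2 _ (hχ.1.update hb)
  simp [usw, h₁, Finset.sum_add_distrib] at h₂

/-- Moving items along a path whose agents are pairwise distinct. -/
lemma IsAlloc.exists_transfer {m n : ℕ} {likes : Fin n → Fin m → Prop} (k : ℕ) :
    ∀ {χ : Fin m → Option (Fin n)}, IsAlloc likes χ → ∀ a : Fin (k + 1) → Fin n,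
      Function.Injective a → ∀ o : Fin k → Fin m,
      (∀ t : Fin k, χ (o t) = some (a t.castSucc) ∧ likes (a t.succ) (o t)) →
      ∃ χ', IsAlloc likes χ' ∧ ∀ w, prof χ' w + (if a 0 = w then 1 else 0) =
        prof χ w + (if a (Fin.last k) = w then 1 else 0) := by
  induction k with
  | zero => exact fun hχ a _ _ _ => ⟨_, hχ, fun w => rfl⟩
  | succ k ih =>
    intro χ hχ a ha o h
    have h0 := h 0
    simp only [Fin.castSucc_zero, Fin.succ_zero_eq_one] at h0
    obtain ⟨χ', hχ', hp⟩ := ih (hχ.update h0.2) (fun t => a t.succ)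
      (fun s t hst => Fin.succ_injective _ (ha hst)) (fun t => o t.succ) fun t => by
        have ht := h t.succ
        refine ⟨?_, ht.2⟩
        rw [Function.update_of_ne, ht.1]
        · rfl
        · intro he
          rw [he, h0.1, Option.some.injEq] at ht
          exact absurd (ha ht.1) (by simp [Fin.ext_iff])
    refine ⟨χ', hχ', fun w => ?_⟩
    have h₁ : _ + (if a 1 = w then 1 else 0) =
      _ + (if a (Fin.last (k + 1)) = w then 1 else 0) := hp w
    have h₂ := prof_update_some χ (o 0) (a 1) w
    simp only [h0.1, Option.some.injEq] at h₂
    omega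

lemma TransferPath.exists_transfer {m n : ℕ} {likes : Fin n → Fin m → Prop}
    {χ : Fin m → Option (Fin n)} {u v : Fin n} (h : TransferPath likes χ u v)
    (hχ : IsAlloc likes χ) :
    ∃ χ', IsAlloc likes χ' ∧ ∀ w, prof χ' w + (if u = w then 1 else 0) =
      prof χ w + (if v = w then 1 else 0) := by
  obtain ⟨k, -, a, ha, rfl, rfl, o, ho⟩ := h
  exact hχ.exists_transfer k a ha o ho

/-- A chain of related elements can be shortened to one without repetitions. -/
lemma Relation.ReflTransGen.exists_injOn_path {α : Type*} {r : α → α → Prop} {u v : α}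
    (h : Relation.ReflTransGen r u v) :
    ∃ (k : ℕ) (f : ℕ → α), f 0 = u ∧ f k = v ∧ Set.InjOn f (Set.Iic k) ∧
      ∀ t < k, r (f t) (f (t + 1)) := by
  induction h using Relation.ReflTransGen.head_induction_on with
  | refl => exact ⟨0, fun _ => v, rfl, rfl, by intro s hs t ht _; simp_all, by simp⟩
  | @head u w huw _ ih =>
    obtain ⟨k, f, rfl, rfl, hinj, hr⟩ := ih
    by_cases hu : ∃ s ≤ k, f s = u
    · obtain ⟨s, hs, rfl⟩ := hu
      refine ⟨k - s, fun t => f (t + s), by simp, by simp [hs], ?_, fun t ht => ?_⟩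
      · intro p hp q hq hpq
        simp only [Set.mem_Iic] at hp hq
        have := hinj (Set.mem_Iic.2 (by omega)) (Set.mem_Iic.2 (by omega)) hpq
        omega
      · have := hr (t + s) (by omega)
        rwa [Nat.add_right_comm] at this
    · push Not at hu
      refine ⟨k + 1, fun t => Nat.casesOn t u f, rfl, rfl, ?_, ?_⟩
      · rintro (_ | p) hp (_ | q) hq hpq
        · rfl
        · exact absurd hpq.symm (hu q (by simpa using hq))
        · exact absurd hpq (hu p (by simpa using hp))
        · rw [hinj (by simpa using hp) (by simpa using hq) hpq]
      · rintro (_ | t) ht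
        · exact huw
        · exact hr t (by omega)

/-- Agent `v` likes some item that `χ` assigns to agent `u`. -/
def Envies {m n : ℕ} (likes : Fin n → Fin m → Prop) (χ : Fin m → Option (Fin n))
    (u v : Fin n) : Prop :=
  ∃ o, χ o = some u ∧ likes v o

lemma transferPath_of_reflTransGen {m n : ℕ} {likes : Fin n → Fin m → Prop}
    {χ : Fin m → Option (Fin n)} {u v : Fin n}
    (h : Relation.ReflTransGen (Envies likes χ) u v) (huv : u ≠ v) :
    TransferPath likes χ u v := by
  obtain ⟨k, f, rfl, rfl, hinj, hr⟩ := h.exists_injOn_path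
  have hr' : ∀ t : Fin k, Envies likes χ (f t) (f (t + 1)) := fun t => hr t t.2
  choose o ho using hr'
  refine ⟨k, Nat.one_le_iff_ne_zero.2 ?_, fun t => f t, ?_, rfl, rfl, o, ho⟩
  · rintro rfl
    exact huv rfl
  · intro s t hst
    exact Fin.ext (hinj (Set.mem_Iic.2 (Nat.lt_succ_iff.1 s.2))
      (Set.mem_Iic.2 (Nat.lt_succ_iff.1 t.2)) hst)

lemma usw_eq_of_transfer {m n : ℕ} {χ χ' : Fin m → Option (Fin n)} {u v : Fin n}
    (h : ∀ w, prof χ' w + (if u = w then 1 else 0) = prof χ w + (if v = w then 1 else 0)) :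
    usw χ' = usw χ := by
  have := Finset.sum_congr (rfl : (Finset.univ : Finset (Fin n)) = _) fun w _ => h w
  simpa [Finset.sum_add_distrib, usw] using this

lemma sum_sq_of_transfer {m n : ℕ} {χ χ' : Fin m → Option (Fin n)} {u v : Fin n}
    (huv : u ≠ v)
    (h : ∀ w, prof χ' w + (if u = w then 1 else 0) = prof χ w + (if v = w then 1 else 0)) :
    ∑ w, prof χ' w ^ 2 + 2 * prof χ u = ∑ w, prof χ w ^ 2 + 2 * prof χ v + 2 := by
  have h₁ : ∀ w, (prof χ' w : ℤ) ^ 2 = (prof χ w : ℤ) ^ 2 +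
      (if v = w then 2 * (prof χ v : ℤ) + 1 else 0) +
      (if u = w then 1 - 2 * (prof χ u : ℤ) else 0) := by
    intro w
    have hw := h w
    by_cases hu : u = w
    · subst hu
      simp only [if_true, if_neg huv.symm, add_zero] at hw ⊢
      rw [← hw]
      push_cast
      ring
    · by_cases hv : v = w
      · subst hv
        simp only [if_true, if_neg hu, add_zero] at hw ⊢
        rw [hw]
        push_cast
        ring
      · simp only [if_neg hu, if_neg hv, add_zero] at hw ⊢
        rw [hw]
  have h₂ := Finset.sum_congr (rfl : (Finset.univ : Finset (Fin n)) = _) fun w _ => h₁ w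
  simp only [Finset.sum_add_distrib, Finset.sum_ite_eq, Finset.mem_univ, if_true] at h₂
  zify
  linarith

lemma MaxUSW.of_transfer {m n : ℕ} {likes : Fin n → Fin m → Prop}
    {χ χ' : Fin m → Option (Fin n)} (hχ : MaxUSW likes χ) (hχ' : IsAlloc likes χ')
    {u v : Fin n}
    (h : ∀ w, prof χ' w + (if u = w then 1 else 0) = prof χ w + (if v = w then 1 else 0)) :
    MaxUSW likes χ' :=
  ⟨hχ', fun χ'' h'' => (hχ.2 χ'' h'').trans_eq (usw_eq_of_transfer h).symm⟩

/-- A max-USW allocation minimizing the sum of squares of its profile. -/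
def MinSq {m n : ℕ} (likes : Fin n → Fin m → Prop) (χ : Fin m → Option (Fin n)) : Prop :=
  MaxUSW likes χ ∧ ∀ χ', MaxUSW likes χ' → ∑ w, prof χ w ^ 2 ≤ ∑ w, prof χ' w ^ 2

lemma exists_minSq {m n : ℕ} (likes : Fin n → Fin m → Prop) : ∃ χ, MinSq likes χ := by
  obtain ⟨χ₀, h₀, h₁⟩ := Set.exists_max_image {χ | IsAlloc likes χ} usw (Set.toFinite _)
    ⟨fun _ => none, fun _ _ h => by simp at h⟩
  obtain ⟨χ, h₂, h₃⟩ := Set.exists_min_image {χ | MaxUSW likes χ}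
    (fun χ => ∑ w, prof χ w ^ 2) (Set.toFinite _) ⟨χ₀, h₀, h₁⟩
  exact ⟨χ, h₂, h₃⟩

lemma MinSq.stable {m n : ℕ} {likes : Fin n → Fin m → Prop} {χ : Fin m → Option (Fin n)}
    (hχ : MinSq likes χ) : Stable likes χ := by
  refine ⟨hχ.1, ?_⟩
  rintro ⟨u, v, huv, hlt⟩
  obtain ⟨χ', hχ', hp⟩ := huv.exists_transfer hχ.1.1
  have hne : u ≠ v := by
    rintro rfl
    omega
  have h₁ := sum_sq_of_transfer hne hp
  have h₂ := hχ.2 χ' (hχ.1.of_transfer hχ' hp)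
  omega

/-- Transferring from `u` to a poorer agent `v` keeps the sum of squares minimal. -/
lemma MinSq.exists_stable_transfer {m n : ℕ} {likes : Fin n → Fin m → Prop}
    {χ : Fin m → Option (Fin n)} (hχ : MinSq likes χ) {u v : Fin n}
    (h : Relation.ReflTransGen (Envies likes χ) u v) (hlt : prof χ v < prof χ u) :
    ∃ χ', Stable likes χ' ∧ prof χ' u < prof χ u ∧ prof χ v < prof χ' v := by
  have hne : u ≠ v := by
    rintro rfl
    omega
  obtain ⟨χ', hχ', hp⟩ := (transferPath_of_reflTransGen h hne).exists_transfer hχ.1.1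
  have h₁ := sum_sq_of_transfer hne hp
  refine ⟨χ', MinSq.stable ⟨hχ.1.of_transfer hχ' hp, fun χ'' h'' => ?_⟩, ?_, ?_⟩
  · have := hχ.2 χ'' h''
    omega
  · have := hp u
    simp only [if_true, if_neg hne.symm] at this
    omega
  · have := hp v
    simp only [if_true, if_neg hne] at this
    omega

lemma Stable.prof_le_of_reflTransGen {m n : ℕ} {likes : Fin n → Fin m → Prop}
    {χ : Fin m → Option (Fin n)} (hχ : Stable likes χ) {u v : Fin n}
    (h : Relation.ReflTransGen (Envies likes χ) u v) : prof χ u ≤ prof χ v + 1 := by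
  by_contra! hlt
  refine hχ.2 ⟨u, v, transferPath_of_reflTransGen h ?_, by omega⟩
  rintro rfl
  omega

/-- In a max-USW divisible allocation every liked item is fully allocated. -/
lemma DMaxUSW.sum_eq_one {m n : ℕ} {likes : Fin n → Fin m → Prop} {x : Fin m → Fin n → ℝ}
    (hx : DMaxUSW likes x) {o : Fin m} {b : Fin n} (hb : likes b o) : ∑ j, x o j = 1 := by
  classical
  obtain ⟨⟨h0, hl, h1⟩, hmax⟩ := hx
  refine le_antisymm (h1 o) ?_
  have h₁ : ∀ o', ∑ j, (x o' j + if o' = o ∧ j = b then 1 - ∑ j, x o j else 0) =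
      ∑ j, x o' j + if o' = o then 1 - ∑ j, x o j else 0 := fun o' => by
    rw [Finset.sum_add_distrib]
    by_cases ho : o' = o <;> simp [ho]
  have h₂ := hmax (fun o' j => x o' j + if o' = o ∧ j = b then 1 - ∑ j, x o j else 0)
    ⟨fun o' j => ?_, fun o' j hj => ?_, fun o' => ?_⟩
  · simp only [h₁, Finset.sum_add_distrib, Finset.sum_ite_eq', Finset.mem_univ, if_true] at h₂
    linarith
  · have := h0 o' j
    have := h1 o
    dsimp only
    split_ifs <;> linarith
  · have : ¬ (o' = o ∧ j = b) := by
      rintro ⟨rfl, rfl⟩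
      exact hj hb
    simp [this, hl o' j hj]
  · rw [h₁]
    split_ifs with ho
    · subst ho
      linarith
    · simpa using h1 o'

/-- A fraction of an item never belongs to an agent with more income than another agent who
likes that item. -/
lemma DStable.dprof_le {m n : ℕ} {likes : Fin n → Fin m → Prop} {x : Fin m → Fin n → ℝ}
    (hx : DStable likes x) {o : Fin m} {u v : Fin n} (hu : 0 < x o u) (hv : likes v o) :
    dprof x u ≤ dprof x v := by
  by_contra! hlt
  have hne : u ≠ v := by
    rintro rfl
    exact lt_irrefl _ hlt
  refine hx.2 ⟨u, v, ⟨1, le_rfl, ![u, v], ?_, rfl, rfl, fun _ => o, fun t => ?_⟩, hlt⟩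
  · intro s t
    fin_cases s <;> fin_cases t <;> simp [hne, hne.symm]
  · fin_cases t
    exact ⟨hu, hv⟩

lemma sum_prof_eq {m n : ℕ} (χ : Fin m → Option (Fin n)) (S : Finset (Fin n)) :
    ∑ j ∈ S, (prof χ j : ℝ) = ∑ o, ∑ j ∈ S, if χ o = some j then 1 else 0 := by
  rw [Finset.sum_comm]
  simp [prof]

lemma sum_dprof_eq {m n : ℕ} (x : Fin m → Fin n → ℝ) (S : Finset (Fin n)) :
    ∑ j ∈ S, dprof x j = ∑ o, ∑ j ∈ S, x o j := by
  rw [Finset.sum_comm]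
  rfl

/-- If `i` has divisible income less than `c`, then in `χ` the agent `i` can reach an agent
with fewer than `c` items. -/
lemma DStable.exists_reachable_lt {m n : ℕ} {likes : Fin n → Fin m → Prop}
    {x : Fin m → Fin n → ℝ} (hx : DStable likes x) {χ : Fin m → Option (Fin n)}
    (hχ : IsAlloc likes χ) {i : Fin n} {c : ℝ} (hi : dprof x i < c) :
    ∃ j, Relation.ReflTransGen (Envies likes χ) i j ∧ (prof χ j : ℝ) < c := by
  classical
  by_contra! hcon
  set S : Finset (Fin n) := Finset.univ.filter fun j =>
    Relation.ReflTransGen (Envies likes χ) i j ∧ dprof x j < c with hS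
  have hiS : i ∈ S := by simp [hS, hi, Relation.ReflTransGen.refl]
  have hlt : ∑ j ∈ S, dprof x j < ∑ j ∈ S, (prof χ j : ℝ) := by
    refine Finset.sum_lt_sum_of_nonempty ⟨i, hiS⟩ fun j hj => ?_
    obtain ⟨hj, hjc⟩ := (Finset.mem_filter.1 hj).2
    exact hjc.trans_le (hcon j hj)
  refine hlt.not_ge ?_
  rw [sum_prof_eq, sum_dprof_eq]
  refine Finset.sum_le_sum fun o _ => ?_
  by_cases ho : ∃ s ∈ S, χ o = some s
  · obtain ⟨s, hs, hos⟩ := ho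
    have hso := hχ o s hos
    have h₁ : ∑ j ∈ S, x o j = ∑ j, x o j := by
      refine Finset.sum_subset (Finset.subset_univ S) fun j _ hj => ?_
      by_contra hne
      have hpos := (hx.1.1.1 o j).lt_of_ne' hne
      have hjo : likes j o := by
        by_contra hjo
        exact hne (hx.1.1.2.1 o j hjo)
      obtain ⟨hs₁, hs₂⟩ := (Finset.mem_filter.1 hs).2
      exact hj (Finset.mem_filter.2 ⟨Finset.mem_univ j, hs₁.tail ⟨o, hos, hjo⟩,
        (hx.dprof_le hpos hso).trans_lt hs₂⟩)
    rw [h₁, hx.1.sum_eq_one hso]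
    simp [hos, hs]
  · push Not at ho
    rw [Finset.sum_eq_zero fun j hj => if_neg (ho j hj)]
    exact Finset.sum_nonneg fun j _ => hx.1.1.1 o j

/-- If `i` has divisible income more than `c`, then in `χ` the agent `i` is reachable from an
agent with more than `c` items. -/
lemma DStable.exists_reaching_gt {m n : ℕ} {likes : Fin n → Fin m → Prop}
    {x : Fin m → Fin n → ℝ} (hx : DStable likes x) {χ : Fin m → Option (Fin n)}
    (hχ : MaxUSW likes χ) {i : Fin n} {c : ℝ} (hi : c < dprof x i) :
    ∃ j, Relation.ReflTransGen (Envies likes χ) j i ∧ c < (prof χ j : ℝ) := by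
  classical
  by_contra! hcon
  set S : Finset (Fin n) := Finset.univ.filter fun j =>
    Relation.ReflTransGen (Envies likes χ) j i ∧ c < dprof x j with hS
  have hiS : i ∈ S := by simp [hS, hi, Relation.ReflTransGen.refl]
  have hlt : ∑ j ∈ S, (prof χ j : ℝ) < ∑ j ∈ S, dprof x j := by
    refine Finset.sum_lt_sum_of_nonempty ⟨i, hiS⟩ fun j hj => ?_
    obtain ⟨hj, hjc⟩ := (Finset.mem_filter.1 hj).2
    exact (hcon j hj).trans_lt hjc
  refine hlt.not_ge ?_
  rw [sum_prof_eq, sum_dprof_eq]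
  refine Finset.sum_le_sum fun o _ => ?_
  by_cases ho : ∃ j ∈ S, x o j ≠ 0
  · obtain ⟨j, hj, hne⟩ := ho
    have hpos := (hx.1.1.1 o j).lt_of_ne' hne
    have hjo : likes j o := by
      by_contra hjo
      exact hne (hx.1.1.2.1 o j hjo)
    obtain ⟨s, hos⟩ := hχ.exists_owner hjo
    obtain ⟨hj₁, hj₂⟩ := (Finset.mem_filter.1 hj).2
    have hs : s ∈ S := Finset.mem_filter.2 ⟨Finset.mem_univ s, hj₁.head ⟨o, hos, hjo⟩,
      hj₂.trans_le (hx.dprof_le hpos (hχ.1 o s hos))⟩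
    have h₁ : ∑ j ∈ S, x o j ≤ ∑ j, x o j :=
      Finset.sum_le_sum_of_subset_of_nonneg (Finset.subset_univ S)
        fun j _ _ => hx.1.1.1 o j
    simpa [hos, hs] using h₁.trans (hx.1.1.2.2 o)
  · push Not at ho
    rw [Finset.sum_eq_zero ho]
    exact Finset.sum_nonneg fun j _ => by split_ifs <;> norm_num

/-- let `x` be a stable divisible allocation for an instance, viewed also
with indivisible items.  (1) If every stable indivisible allocation assigns exactly `d`
items to agent `i`, then `i`'s income under `x` is exactly `d`.  (2) If some stable
indivisible allocation assigns exactly `d` items to `i` and some stable indivisible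
allocation assigns exactly `d - 1` items to `i`, then `i`'s income under `x` lies in
`[d - 1, d]`. -/
theorem dstable_income_vs_indivisible_layers {m n : ℕ} (likes : Fin n → Fin m → Prop)
    (x : Fin m → Fin n → ℝ) (hx : DStable likes x) (i : Fin n) (d : ℕ) :
    ((∀ χ : Fin m → Option (Fin n), Stable likes χ → prof χ i = d) →
      dprof x i = (d : ℝ)) ∧
    ((∃ χ : Fin m → Option (Fin n), Stable likes χ ∧ prof χ i = d) →
     (∃ χ : Fin m → Option (Fin n), Stable likes χ ∧ prof χ i + 1 = d) →
      (d : ℝ) - 1 ≤ dprof x i ∧ dprof x i ≤ (d : ℝ)) := by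
  refine ⟨fun hall => ?_, ?_⟩
  · obtain ⟨χ, hχ⟩ := exists_minSq likes
    have hd := hall χ hχ.stable
    refine le_antisymm ?_ ?_
    · by_contra! hlt
      obtain ⟨j, hj, hjd⟩ := hx.exists_reaching_gt hχ.1 hlt
      rw [Nat.cast_lt, ← hd] at hjd
      obtain ⟨χ', hχ', -, h⟩ := hχ.exists_stable_transfer hj hjd
      rw [hall χ' hχ', hd] at h
      exact lt_irrefl _ h
    · by_contra! hlt
      obtain ⟨j, hj, hjd⟩ := hx.exists_reachable_lt hχ.1.1 hlt
      rw [Nat.cast_lt, ← hd] at hjd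
      obtain ⟨χ', hχ', h, -⟩ := hχ.exists_stable_transfer hj hjd
      rw [hall χ' hχ', hd] at h
      exact lt_irrefl _ h
  · rintro ⟨χ₁, hχ₁, h₁⟩ ⟨χ₂, hχ₂, h₂⟩
    constructor
    · by_contra! hlt
      obtain ⟨j, hj, hjd⟩ := hx.exists_reachable_lt hχ₁.1.1 hlt
      have hjd' : prof χ₁ j + 1 < d := by
        rw [lt_sub_iff_add_lt] at hjd
        exact_mod_cast hjd
      have := hχ₁.prof_le_of_reflTransGen hj
      omega
    · by_contra! hlt
      obtain ⟨j, hj, hjd⟩ := hx.exists_reaching_gt hχ₂.1 hlt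
      rw [Nat.cast_lt] at hjd
      have := hχ₂.prof_le_of_reflTransGen hj
      omega
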